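/- Assume (cond1) with |U| = 1 and ρ > 0. Let v* be a bounded C² classical solution of ρ v − F(x, Dv, D²v) = 0 on ℝ^d, and let (v^n)_{n≥1} be the policy iteration sequence (π^{n+1} = Γ(·, Dv^n, D²v^n) and v^{n+1} a classical solution of ρ v^{n+1} − F_{π^{n+1}}(x, Dv^{n+1}, D²v^{n+1}) = 0). If sup_n ‖v^n‖_{2,α} < ∞ for some α ∈ (0,1), then v^n converges to v* in C² locally uniformly: v^n → v*, Dv^n → Dv* and D²v^n → D²v* uniformly on every compact subset of ℝ^d as n → ∞. -/

import Mathlib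

open MeasureTheory Real Metric
noncomputable section

/-- First-order partial derivative `∂v/∂xᵢ`. -/
def pd1 (d : ℕ) (v : EuclideanSpace ℝ (Fin d) → ℝ) (x : EuclideanSpace ℝ (Fin d))
    (i : Fin d) : ℝ :=
  fderiv ℝ v x (EuclideanSpace.single i 1)

/-- Second-order partial derivative `∂²v/∂xᵢ∂xⱼ`. -/
def pd2 (d : ℕ) (v : EuclideanSpace ℝ (Fin d) → ℝ) (x : EuclideanSpace ℝ (Fin d))
    (i j : Fin d) : ℝ :=
  fderiv ℝ (fun y => fderiv ℝ v y (EuclideanSpace.single j 1)) x (EuclideanSpace.single i 1)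

/-- The exponent `(1/λ)(r(x,u) + b(x,u)·p + (1/2) tr(Σ(x,u) X))` of the Gibbs density. -/
def gibbsExponent (d l : ℕ) (lam : ℝ)
    (r : EuclideanSpace ℝ (Fin d) → EuclideanSpace ℝ (Fin l) → ℝ)
    (b : EuclideanSpace ℝ (Fin d) → EuclideanSpace ℝ (Fin l) → Fin d → ℝ)
    (S : EuclideanSpace ℝ (Fin d) → EuclideanSpace ℝ (Fin l) → Matrix (Fin d) (Fin d) ℝ)
    (x : EuclideanSpace ℝ (Fin d)) (p : Fin d → ℝ) (X : Matrix (Fin d) (Fin d) ℝ)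
    (u : EuclideanSpace ℝ (Fin l)) : ℝ :=
  (1 / lam) * (r x u + ∑ i, b x u i * p i + (1 / 2) * ∑ i, ∑ j, S x u i j * X j i)

/-- The Gibbs density `Γ(x,p,X)(u)`. -/
def gibbsDensity (d l : ℕ) (lam : ℝ) (U : Set (EuclideanSpace ℝ (Fin l)))
    (r : EuclideanSpace ℝ (Fin d) → EuclideanSpace ℝ (Fin l) → ℝ)
    (b : EuclideanSpace ℝ (Fin d) → EuclideanSpace ℝ (Fin l) → Fin d → ℝ)
    (S : EuclideanSpace ℝ (Fin d) → EuclideanSpace ℝ (Fin l) → Matrix (Fin d) (Fin d) ℝ)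
    (x : EuclideanSpace ℝ (Fin d)) (p : Fin d → ℝ) (X : Matrix (Fin d) (Fin d) ℝ)
    (u : EuclideanSpace ℝ (Fin l)) : ℝ :=
  Real.exp (gibbsExponent d l lam r b S x p X u) /
    ∫ u' in U, Real.exp (gibbsExponent d l lam r b S x p X u')

/-- The Hessian matrix of `v` at `x`. -/
def hessian (d : ℕ) (v : EuclideanSpace ℝ (Fin d) → ℝ) (x : EuclideanSpace ℝ (Fin d)) :
    Matrix (Fin d) (Fin d) ℝ :=
  Matrix.of fun i j => pd2 d v x i j

/-- The policy `π(x,·) = Γ(x, Dv(x), D²v(x))` obtained from a value function `v`. -/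
def gibbsPolicy (d l : ℕ) (lam : ℝ) (U : Set (EuclideanSpace ℝ (Fin l)))
    (r : EuclideanSpace ℝ (Fin d) → EuclideanSpace ℝ (Fin l) → ℝ)
    (b : EuclideanSpace ℝ (Fin d) → EuclideanSpace ℝ (Fin l) → Fin d → ℝ)
    (S : EuclideanSpace ℝ (Fin d) → EuclideanSpace ℝ (Fin l) → Matrix (Fin d) (Fin d) ℝ)
    (v : EuclideanSpace ℝ (Fin d) → ℝ)
    (x : EuclideanSpace ℝ (Fin d)) (u : EuclideanSpace ℝ (Fin l)) : ℝ :=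
  gibbsDensity d l lam U r b S x (fun i => pd1 d v x i) (hessian d v x) u


/-- The exploratory (entropy-regularized) Hamiltonian
`F(x,p,X) = λ ln ∫_U exp[(1/λ)(r + b·p + (1/2) tr(Σ X))] du`. -/
def expF (d l : ℕ) (lam : ℝ) (U : Set (EuclideanSpace ℝ (Fin l)))
    (r : EuclideanSpace ℝ (Fin d) → EuclideanSpace ℝ (Fin l) → ℝ)
    (b : EuclideanSpace ℝ (Fin d) → EuclideanSpace ℝ (Fin l) → Fin d → ℝ)
    (S : EuclideanSpace ℝ (Fin d) → EuclideanSpace ℝ (Fin l) → Matrix (Fin d) (Fin d) ℝ)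
    (x : EuclideanSpace ℝ (Fin d)) (p : Fin d → ℝ) (X : Matrix (Fin d) (Fin d) ℝ) : ℝ :=
  lam * Real.log (∫ u in U, Real.exp (gibbsExponent d l lam r b S x p X u))

/-- A differentiable map whose derivative is Hölder continuous at unit scale has a first-order
Taylor expansion with a controlled remainder. -/
theorem norm_taylor_one_le_of_fderiv_holder {E F : Type*}
    [NormedAddCommGroup E] [NormedSpace ℝ E] [NormedAddCommGroup F] [NormedSpace ℝ F]
    {f : E → F} {K α : ℝ} (hα : 0 < α) (hK : 0 ≤ K) (hf : Differentiable ℝ f)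
    (hhol : ∀ x y, dist x y ≤ 1 → ‖fderiv ℝ f x - fderiv ℝ f y‖ ≤ K * dist x y ^ α)
    {x y : E} (hxy : dist y x ≤ 1) :
    ‖f y - f x - fderiv ℝ f x (y - x)‖ ≤ K * dist y x ^ α * ‖y - x‖ := by
  refine Convex.norm_image_sub_le_of_norm_fderiv_le' (s := closedBall x (dist y x)) (𝕜 := ℝ)
    (fun z _ => hf z) (fun z hz => ?_) (convex_closedBall _ _)
    (mem_closedBall_self dist_nonneg) (mem_closedBall.2 le_rfl)
  have hz' : dist z x ≤ dist y x := hz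
  refine (hhol z x (hz'.trans hxy)).trans ?_
  gcongr

/-- Pointwise limits of maps with bounded, uniformly Hölder derivatives are differentiable, and
the derivatives converge pointwise. -/
theorem tendsto_fderiv_of_holder {E F : Type*}
    [NormedAddCommGroup E] [NormedSpace ℝ E] [FiniteDimensional ℝ E]
    [NormedAddCommGroup F] [NormedSpace ℝ F] [FiniteDimensional ℝ F]
    {f : ℕ → E → F} {g : E → F} {K α : ℝ} (hα : 0 < α)
    (hf : ∀ n, Differentiable ℝ (f n)) (hbdd : ∀ n x, ‖fderiv ℝ (f n) x‖ ≤ K)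
    (hhol : ∀ n x y, dist x y ≤ 1 →
      ‖fderiv ℝ (f n) x - fderiv ℝ (f n) y‖ ≤ K * dist x y ^ α)
    (hlim : ∀ x, Filter.Tendsto (fun n => f n x) Filter.atTop (nhds (g x))) :
    Differentiable ℝ g ∧
      ∀ x, Filter.Tendsto (fun n => fderiv ℝ (f n) x) Filter.atTop (nhds (fderiv ℝ g x)) := by
  have hK : 0 ≤ K := (norm_nonneg _).trans (hbdd 0 0)
  have : ProperSpace (E →L[ℝ] F) := FiniteDimensional.proper ℝ _
  have key : ∀ x (φ : ℕ → ℕ) (L : E →L[ℝ] F), Filter.Tendsto φ Filter.atTop Filter.atTop →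
      Filter.Tendsto (fun n => fderiv ℝ (f (φ n)) x) Filter.atTop (nhds L) →
      HasFDerivAt g L x := by
    intro x φ L hφ hL
    have hbound : ∀ y, dist y x ≤ 1 →
        ‖g y - g x - L (y - x)‖ ≤ K * dist y x ^ α * ‖y - x‖ := by
      intro y hy
      refine le_of_tendsto (f := fun n => ‖f (φ n) y - f (φ n) x - fderiv ℝ (f (φ n)) x (y - x)‖)
        (x := Filter.atTop) ?_ (Filter.Eventually.of_forall fun n =>
          norm_taylor_one_le_of_fderiv_holder hα hK (hf _) (hhol _) hy)
      refine (((hlim y).comp hφ).sub ((hlim x).comp hφ) |>.sub ?_).norm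
      exact ((ContinuousLinearMap.apply ℝ F (y - x)).continuous.tendsto L).comp hL
    rw [hasFDerivAt_iff_isLittleO, Asymptotics.isLittleO_iff]
    intro c hc
    have h0 : Filter.Tendsto (fun y => K * dist y x ^ α) (nhds x) (nhds 0) := by
      have : Continuous fun y => K * dist y x ^ α :=
        continuous_const.mul ((continuous_id.dist continuous_const).rpow_const
          fun _ => Or.inr hα.le)
      simpa [Real.zero_rpow hα.ne'] using this.tendsto x
    filter_upwards [h0.eventually_lt_const hc, closedBall_mem_nhds x one_pos] with y hy hy1
    exact (hbound y hy1).trans (by gcongr)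
  have hsub : ∀ x (ns : ℕ → ℕ), Filter.Tendsto ns Filter.atTop Filter.atTop →
      ∃ L, HasFDerivAt g L x ∧ ∃ ms : ℕ → ℕ,
        Filter.Tendsto (fun n => fderiv ℝ (f (ns (ms n))) x) Filter.atTop (nhds L) := by
    intro x ns hns
    obtain ⟨L, -, φ, hφ, hL⟩ := tendsto_subseq_of_bounded (isBounded_closedBall (x := 0) (r := K))
      (x := fun n => fderiv ℝ (f (ns n)) x) (fun n => by simpa using hbdd (ns n) x)
    exact ⟨L, key x _ L (hns.comp hφ.tendsto_atTop) hL, φ, hL⟩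
  refine ⟨fun x => ?_, fun x => ?_⟩
  · obtain ⟨L, hL, -⟩ := hsub x id Filter.tendsto_id
    exact hL.differentiableAt
  · refine Filter.tendsto_of_subseq_tendsto fun ns hns => ?_
    obtain ⟨L, hL, ms, hms⟩ := hsub x ns hns
    exact ⟨ms, hL.fderiv ▸ hms⟩

/-- Pointwise convergence of uniformly Hölder maps is uniform on compact sets. -/
theorem tendstoUniformlyOn_of_holder {E F : Type*} [PseudoMetricSpace E]
    [SeminormedAddCommGroup F] {f : ℕ → E → F} {g : E → F} {K α : ℝ} (hα : 0 < α)
    (hhol : ∀ n x y, dist x y ≤ 1 → ‖f n x - f n y‖ ≤ K * dist x y ^ α)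
    (hlim : ∀ x, Filter.Tendsto (fun n => f n x) Filter.atTop (nhds (g x)))
    {s : Set E} (hs : IsCompact s) :
    TendstoUniformlyOn f g Filter.atTop s := by
  rw [← tendstoLocallyUniformlyOn_iff_tendstoUniformlyOn_of_compact hs,
    Metric.tendstoLocallyUniformlyOn_iff]
  intro ε hε x _
  have h0 : Filter.Tendsto (fun y => K * dist y x ^ α) (nhds x) (nhds 0) := by
    have : Continuous fun y => K * dist y x ^ α :=
      continuous_const.mul ((continuous_id.dist continuous_const).rpow_const
        fun _ => Or.inr hα.le)
    simpa [Real.zero_rpow hα.ne'] using this.tendsto x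
  refine ⟨{y | K * dist y x ^ α < ε / 3} ∩ closedBall x 1, mem_nhdsWithin_of_mem_nhds
    (Filter.inter_mem (h0.eventually_lt_const (by positivity))
      (closedBall_mem_nhds x one_pos)), ?_⟩
  filter_upwards [Metric.tendsto_nhds.1 (hlim x) (ε / 3) (by positivity)] with n hn y hy
  have h1 : dist (f n y) (f n x) < ε / 3 := by
    rw [dist_eq_norm]; exact (hhol n y x hy.2).trans_lt hy.1
  have h2 : dist (g y) (g x) ≤ ε / 3 := by
    refine le_of_tendsto ((hlim y).dist (hlim x)) (Filter.Eventually.of_forall fun m => ?_)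
    rw [dist_eq_norm]; exact (hhol m y x hy.2).trans hy.1.le
  have h3 := dist_triangle4 (g y) (g x) (f n x) (f n y)
  rw [dist_comm (g x), dist_comm (f n x) (f n y)] at h3
  linarith

/-- Differences of second Fréchet derivatives have the same norm as the corresponding differences
of second iterated derivatives. -/
theorem norm_fderiv_fderiv_sub_eq {E F : Type*}
    [NormedAddCommGroup E] [NormedSpace ℝ E] [NormedAddCommGroup F] [NormedSpace ℝ F]
    (f g : E → F) (x y : E) :
    ‖fderiv ℝ (fderiv ℝ f) x - fderiv ℝ (fderiv ℝ g) y‖ =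
      ‖iteratedFDeriv ℝ 2 f x - iteratedFDeriv ℝ 2 g y‖ := by
  apply le_antisymm
  · refine ContinuousLinearMap.opNorm_le_bound₂ _ (norm_nonneg _) fun h k => ?_
    have := (iteratedFDeriv ℝ 2 f x - iteratedFDeriv ℝ 2 g y).le_opNorm ![h, k]
    simpa [iteratedFDeriv_two_apply, Fin.prod_univ_two, mul_assoc] using this
  · refine ContinuousMultilinearMap.opNorm_le_bound (by positivity) fun m => ?_
    have := (fderiv ℝ (fderiv ℝ f) x - fderiv ℝ (fderiv ℝ g) y).le_opNorm₂ (m 0) (m 1)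
    simpa [iteratedFDeriv_two_apply, Fin.prod_univ_two, mul_assoc] using this

theorem norm_fderiv_fderiv_eq {E F : Type*}
    [NormedAddCommGroup E] [NormedSpace ℝ E] [NormedAddCommGroup F] [NormedSpace ℝ F]
    (f : E → F) (x : E) :
    ‖fderiv ℝ (fderiv ℝ f) x‖ = ‖iteratedFDeriv ℝ 2 f x‖ := by
  rw [← norm_iteratedFDeriv_fderiv (n := 1), ← norm_iteratedFDeriv_fderiv (n := 0),
    norm_iteratedFDeriv_zero]

/-- Second-order necessary condition for a maximum of a function of one variable. -/
theorem deriv_deriv_nonpos_of_forall_le {f : ℝ → ℝ} {a : ℝ}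
    (hf : ContinuousAt f a) (hmax : ∀ t, f t ≤ f a) : deriv (deriv f) a ≤ 0 := by
  by_contra! hpos
  have hd : deriv f a = 0 := IsLocalMax.deriv_eq_zero (Filter.Eventually.of_forall hmax)
  have hmin := isLocalMin_of_deriv_deriv_pos hpos hd hf
  have hconst : f =ᶠ[nhds a] fun _ => f a := hmin.mono fun t ht => le_antisymm (hmax t) ht
  have := hconst.deriv.deriv_eq
  simp at this
  linarith

/-- The trace of the product of a matrix with nonnegative quadratic form and a symmetric
negative semidefinite matrix is nonpositive. -/
theorem sum_mul_nonpos_of_quadratic_nonneg {n : Type*} [Fintype n]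
    {A H : Matrix n n ℝ} (hA : ∀ ξ : n → ℝ, 0 ≤ ∑ i, ∑ j, ξ i * A i j * ξ j)
    (hsymm : ∀ i j, H i j = H j i) (hH : ∀ ξ : n → ℝ, ∑ i, ∑ j, ξ i * H i j * ξ j ≤ 0) :
    ∑ i, ∑ j, A i j * H j i ≤ 0 := by
  classical
  have hpos : (-H).PosSemidef := by
    refine Matrix.PosSemidef.of_dotProduct_mulVec_nonneg ?_ fun ξ => ?_
    · ext i j; simp [hsymm i j]
    · have := hH ξ
      simp only [dotProduct, Matrix.mulVec, Matrix.neg_apply, Pi.star_apply, star_trivial,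
        Finset.mul_sum, neg_mul, mul_neg, Finset.sum_neg_distrib, ← mul_assoc]
      linarith
  obtain ⟨m, B, hB⟩ := Matrix.posSemidef_iff_eq_sum_vecMulVec.mp hpos
  have hH' : ∀ i j, H j i = -∑ k, B k j * B k i := by
    intro i j
    have := congrFun (congrFun hB j) i
    simp [Matrix.sum_apply, Matrix.vecMulVec_apply] at this
    linarith
  have : ∑ i, ∑ j, A i j * H j i = -∑ k, ∑ i, ∑ j, B k i * A i j * B k j := by
    rw [Finset.sum_comm, ← Finset.sum_neg_distrib]
    simp only [hH', mul_neg, Finset.mul_sum, Finset.sum_neg_distrib]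
    rw [neg_inj, Finset.sum_comm]
    conv_rhs => rw [Finset.sum_comm]
    refine Finset.sum_congr rfl fun i _ => ?_
    rw [Finset.sum_comm]
    refine Finset.sum_congr rfl fun j _ => Finset.sum_congr rfl fun k _ => by ring
  rw [this]
  exact neg_nonpos.2 (Finset.sum_nonneg fun k _ => hA _)

theorem pd2_eq_fderiv_fderiv {d : ℕ} {w : EuclideanSpace ℝ (Fin d) → ℝ}
    (hw : Differentiable ℝ (fderiv ℝ w)) (x : EuclideanSpace ℝ (Fin d)) (i j : Fin d) :
    pd2 d w x i j =
      fderiv ℝ (fderiv ℝ w) x (EuclideanSpace.single i 1) (EuclideanSpace.single j 1) := by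
  rw [pd2, fderiv_clm_apply (hw x) (differentiableAt_const _)]
  simp

theorem pd2_symm {d : ℕ} {w : EuclideanSpace ℝ (Fin d) → ℝ} (hw : Differentiable ℝ w)
    (hw' : Differentiable ℝ (fderiv ℝ w)) (x : EuclideanSpace ℝ (Fin d)) (i j : Fin d) :
    pd2 d w x i j = pd2 d w x j i := by
  rw [pd2_eq_fderiv_fderiv hw', pd2_eq_fderiv_fderiv hw']
  exact second_derivative_symmetric (fun y => (hw y).hasFDerivAt) (hw' x).hasFDerivAt _ _

theorem sum_sum_mul_pd2_mul {d : ℕ} {w : EuclideanSpace ℝ (Fin d) → ℝ}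
    (hw' : Differentiable ℝ (fderiv ℝ w)) (x : EuclideanSpace ℝ (Fin d)) (ξ : Fin d → ℝ) :
    ∑ i, ∑ j, ξ i * pd2 d w x i j * ξ j =
      fderiv ℝ (fderiv ℝ w) x (WithLp.toLp 2 ξ) (WithLp.toLp 2 ξ) := by
  have hξ : WithLp.toLp 2 ξ = ∑ i, ξ i • EuclideanSpace.single i (1 : ℝ) := by
    ext j
    simp [Finset.sum_apply, Pi.single_apply]
  rw [hξ]
  simp only [pd2_eq_fderiv_fderiv hw', map_sum, map_smul, sum_apply,
    smul_apply, smul_eq_mul, Finset.mul_sum]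
  rw [Finset.sum_comm]
  exact Finset.sum_congr rfl fun i _ => Finset.sum_congr rfl fun j _ => by ring

/-- First- and second-order conditions at a maximum of `w - ε ‖·‖²`. -/
theorem fderiv_conditions_of_max_sub_norm_sq {E : Type*} [NormedAddCommGroup E]
    [InnerProductSpace ℝ E] {w : E → ℝ} (hw : Differentiable ℝ w)
    (hw' : Differentiable ℝ (fderiv ℝ w)) {ε : ℝ} {x : E}
    (hmax : ∀ y, w y - ε * ‖y‖ ^ 2 ≤ w x - ε * ‖x‖ ^ 2) (ξ : E) :
    fderiv ℝ w x ξ = 2 * ε * inner ℝ x ξ ∧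
      fderiv ℝ (fderiv ℝ w) x ξ ξ ≤ 2 * ε * ‖ξ‖ ^ 2 := by
  set g : ℝ → ℝ := fun t => w (x + t • ξ) - ε * ‖x + t • ξ‖ ^ 2 with hg
  have hline : ∀ t : ℝ, HasDerivAt (fun t : ℝ => x + t • ξ) ξ t := fun t => by
    simpa using ((hasDerivAt_id t).smul_const ξ).const_add x
  have hg1 : ∀ t, HasDerivAt g
      (fderiv ℝ w (x + t • ξ) ξ - ε * (2 * inner ℝ (x + t • ξ) ξ)) t := fun t =>
    ((hw _).hasFDerivAt.comp_hasDerivAt t (hline t)).sub ((hline t).norm_sq.const_mul ε)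
  have hg1' : deriv g = fun t => fderiv ℝ w (x + t • ξ) ξ - ε * (2 * inner ℝ (x + t • ξ) ξ) :=
    funext fun t => (hg1 t).deriv
  have hg2 : HasDerivAt (deriv g)
      (fderiv ℝ (fderiv ℝ w) x ξ ξ - ε * (2 * inner ℝ ξ ξ)) 0 := by
    rw [hg1']
    have h1 : HasDerivAt (fun t : ℝ => fderiv ℝ w (x + t • ξ))
        (fderiv ℝ (fderiv ℝ w) (x + (0 : ℝ) • ξ) ξ) 0 :=
      (hw' _).hasFDerivAt.comp_hasDerivAt 0 (hline 0)
    have h2 := h1.clm_apply (hasDerivAt_const (0 : ℝ) ξ)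
    have h3 := (hline 0).inner ℝ (hasDerivAt_const (0 : ℝ) ξ)
    refine (h2.sub ((h3.const_mul 2).const_mul ε)).congr_deriv ?_
    simp
  have hm : ∀ t, g t ≤ g 0 := fun t => by simpa [hg] using hmax (x + t • ξ)
  have h0 : deriv g 0 = 0 := IsLocalMax.deriv_eq_zero (Filter.Eventually.of_forall hm)
  have h2 := deriv_deriv_nonpos_of_forall_le (hg1 0).continuousAt hm
  rw [hg2.deriv, real_inner_self_eq_norm_sq] at h2
  rw [hg1'] at h0
  simp only [zero_smul, add_zero] at h0
  constructor <;> linarith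

/-- Maximum principle on the whole space: a twice differentiable function which is bounded above
and satisfies `ρ w ≤ B · Dw + (1/2) tr(A D²w)` with bounded coefficients is nonpositive. -/
theorem nonpos_of_elliptic_subsolution {d : ℕ} {ρ C : ℝ} (hρ : 0 < ρ)
    {w : EuclideanSpace ℝ (Fin d) → ℝ} {B : EuclideanSpace ℝ (Fin d) → Fin d → ℝ}
    {A : EuclideanSpace ℝ (Fin d) → Matrix (Fin d) (Fin d) ℝ}
    (hw : Differentiable ℝ w) (hw' : Differentiable ℝ (fderiv ℝ w))
    (hbdd : ∃ M, ∀ x, w x ≤ M) (hB : ∀ x i, |B x i| ≤ C) (hA : ∀ x i j, |A x i j| ≤ C)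
    (hpos : ∀ x (ξ : Fin d → ℝ), 0 ≤ ∑ i, ∑ j, ξ i * A x i j * ξ j)
    (hsub : ∀ x, ρ * w x ≤
      ∑ i, B x i * pd1 d w x i + (1 / 2) * ∑ i, ∑ j, A x i j * pd2 d w x j i)
    (x₀ : EuclideanSpace ℝ (Fin d)) : w x₀ ≤ 0 := by
  obtain ⟨M, hM⟩ := hbdd
  have key : ∀ ε > 0, ρ * w x₀ ≤ ε * (d * C + d * (C ^ 2 / ρ) + ρ * ‖x₀‖ ^ 2) := by
    intro ε hε
    have hcont : Continuous fun y => w y - ε * ‖y‖ ^ 2 := by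
      have := hw.continuous
      fun_prop
    have htend : Filter.Tendsto (fun y : EuclideanSpace ℝ (Fin d) => w y - ε * ‖y‖ ^ 2)
        (Filter.cocompact _) Filter.atBot := by
      have h1 : Filter.Tendsto (fun y : EuclideanSpace ℝ (Fin d) => M + -(ε * ‖y‖ ^ 2))
          (Filter.cocompact _) Filter.atBot :=
        Filter.tendsto_atBot_add_const_left _ _ (Filter.tendsto_neg_atTop_atBot.comp
          (((Filter.tendsto_pow_atTop two_ne_zero).comp
            (tendsto_norm_cocompact_atTop)).const_mul_atTop hε))
      refine Filter.tendsto_atBot_mono (fun y => ?_) h1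
      have := hM y
      linarith
    obtain ⟨x, hx⟩ := hcont.exists_forall_ge htend
    have hcond := fderiv_conditions_of_max_sub_norm_sq hw hw' hx
    have h1 : ∀ i, pd1 d w x i = 2 * ε * x i := by
      intro i
      rw [pd1, (hcond _).1, EuclideanSpace.inner_single_right]
      simp
    have hsq : ‖x‖ ^ 2 = ∑ i, x i ^ 2 := by simp [EuclideanSpace.norm_sq_eq]
    have hdrift : ∑ i, B x i * pd1 d w x i ≤ ε * (ρ * ‖x‖ ^ 2 + d * (C ^ 2 / ρ)) := by
      have : ∀ i, B x i * pd1 d w x i ≤ ε * (ρ * x i ^ 2 + C ^ 2 / ρ) := by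
        intro i
        have hC2 : B x i ^ 2 ≤ C ^ 2 := sq_le_sq' (abs_le.1 (hB x i)).1 (abs_le.1 (hB x i)).2
        have hyoung : 2 * (B x i * x i) ≤ ρ * x i ^ 2 + C ^ 2 / ρ := by
          rw [← sub_nonneg]
          have : ρ * x i ^ 2 + C ^ 2 / ρ - 2 * (B x i * x i) =
              ((ρ * x i - B x i) ^ 2 + (C ^ 2 - B x i ^ 2)) / ρ := by
            field_simp
            ring
          rw [this]
          exact div_nonneg (add_nonneg (sq_nonneg _) (by linarith)) hρ.le
        rw [h1]
        nlinarith
      refine (Finset.sum_le_sum fun i _ => this i).trans_eq ?_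
      rw [← Finset.mul_sum, Finset.sum_add_distrib, ← Finset.mul_sum, hsq]
      simp
    have hdiff : (1 / 2) * ∑ i, ∑ j, A x i j * pd2 d w x j i ≤ ε * (d * C) := by
      have htr := sum_mul_nonpos_of_quadratic_nonneg (A := A x)
        (H := Matrix.of (pd2 d w x) - (2 * ε) • (1 : Matrix (Fin d) (Fin d) ℝ)) (hpos x)
        (fun i j => by
          simp [pd2_symm hw hw' x i j, Matrix.one_apply, eq_comm])
        (fun ξ => by
          have h2 := (hcond (WithLp.toLp 2 ξ)).2
          rw [← sum_sum_mul_pd2_mul hw', EuclideanSpace.norm_sq_eq] at h2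
          simp only [Real.norm_eq_abs, sq_abs] at h2
          simp only [Matrix.sub_apply, Matrix.of_apply, Matrix.smul_apply, Matrix.one_apply,
            smul_eq_mul, mul_ite, mul_one, mul_zero, mul_sub, sub_mul, ite_mul, zero_mul,
            Finset.sum_sub_distrib, Finset.sum_ite_eq, Finset.mem_univ, if_true]
          rw [sub_nonpos]
          refine h2.trans_eq ?_
          rw [Finset.mul_sum]
          exact Finset.sum_congr rfl fun i _ => by ring)
      simp only [Matrix.sub_apply, Matrix.of_apply, Matrix.smul_apply, Matrix.one_apply,
        smul_eq_mul, mul_ite, mul_one, mul_zero, mul_sub, Finset.sum_sub_distrib,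
        Finset.sum_ite_eq', Finset.mem_univ, if_true] at htr
      have hdiag : ∑ i, A x i i * (2 * ε) ≤ d * (C * (2 * ε)) := by
        refine (Finset.sum_le_sum (g := fun _ => C * (2 * ε)) fun i _ => ?_).trans_eq (by simp)
        exact mul_le_mul_of_nonneg_right (abs_le.1 (hA x i i)).2 (by positivity)
      linarith
    have := hsub x
    have := mul_le_mul_of_nonneg_left (hx x₀) hρ.le
    nlinarith
  have hlim : Filter.Tendsto (fun ε : ℝ => ε * (d * C + d * (C ^ 2 / ρ) + ρ * ‖x₀‖ ^ 2))
      (nhdsWithin 0 (Set.Ioi 0)) (nhds 0) := by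
    have : Continuous fun ε : ℝ => ε * (d * C + d * (C ^ 2 / ρ) + ρ * ‖x₀‖ ^ 2) := by fun_prop
    simpa using (this.tendsto 0).mono_left nhdsWithin_le_nhds
  have hle : ρ * w x₀ ≤ 0 := ge_of_tendsto hlim (Filter.eventually_of_mem self_mem_nhdsWithin key)
  exact nonpos_of_mul_nonpos_right hle hρ

/-- Gibbs variational inequality: the entropy-regularized payoff of any positive probability
density is at most the log-partition function. -/
theorem integral_sub_log_mul_le_log_integral_exp {Ω : Type*} [MeasurableSpace Ω]
    {μ : Measure Ω} [IsProbabilityMeasure μ] {f q : Ω → ℝ} (hf : Integrable (fun u => exp (f u)) μ)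
    (hq : Integrable q μ) (hq0 : ∀ u, 0 < q u) (hq1 : ∫ u, q u ∂μ = 1)
    (hfq : Integrable (fun u => (f u - log (q u)) * q u) μ) :
    ∫ u, (f u - log (q u)) * q u ∂μ ≤ log (∫ u, exp (f u) ∂μ) := by
  have hZ : 0 < ∫ u, exp (f u) ∂μ := integral_exp_pos hf
  set Z := ∫ u, exp (f u) ∂μ
  have hpt : ∀ u, (f u - log (q u)) * q u ≤ log Z * q u + (exp (f u) / Z - q u) := by
    intro u
    have h1 := add_one_le_exp (f u - log Z - log (q u))
    rw [exp_sub, exp_sub, exp_log hZ, exp_log (hq0 u), le_div_iff₀ (hq0 u)] at h1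
    linarith
  have := integral_mono hfq ((hq.const_mul (log Z)).add ((hf.div_const Z).sub hq)) hpt
  refine this.trans_eq ?_
  rw [integral_add' (hq.const_mul _) ((hf.div_const Z).sub hq), integral_sub' (hf.div_const Z) hq,
    integral_const_mul, integral_div, hq1, div_self hZ.ne']
  ring

/-- Measurability, boundedness and ellipticity of the control coefficients. -/
structure AdmissibleCoefficients (d l : ℕ) (C₀ : ℝ) (U : Set (EuclideanSpace ℝ (Fin l)))
    (r : EuclideanSpace ℝ (Fin d) → EuclideanSpace ℝ (Fin l) → ℝ)
    (b : EuclideanSpace ℝ (Fin d) → EuclideanSpace ℝ (Fin l) → Fin d → ℝ)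
    (S : EuclideanSpace ℝ (Fin d) → EuclideanSpace ℝ (Fin l) → Matrix (Fin d) (Fin d) ℝ) :
    Prop where
  measurableSet : MeasurableSet U
  volume_eq_one : volume U = 1
  measurable_r : ∀ x, Measurable fun u => r x u
  measurable_b : ∀ x i, Measurable fun u => b x u i
  measurable_S : ∀ x i j, Measurable fun u => S x u i j
  quadratic_nonneg : ∀ u ∈ U, ∀ x (ξ : Fin d → ℝ), 0 ≤ ∑ i, ∑ j, ξ i * S x u i j * ξ j
  abs_r_le : ∀ u ∈ U, ∀ x, |r x u| ≤ C₀
  abs_b_le : ∀ u ∈ U, ∀ x i, |b x u i| ≤ C₀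
  abs_S_le : ∀ u ∈ U, ∀ x i j, |S x u i j| ≤ C₀

/-- The linear Hamiltonian `F_π(x, Dw, D²w)` for the Gibbs policy `π` generated by `v`. -/
def policyHamiltonian (d l : ℕ) (lam : ℝ) (U : Set (EuclideanSpace ℝ (Fin l)))
    (r : EuclideanSpace ℝ (Fin d) → EuclideanSpace ℝ (Fin l) → ℝ)
    (b : EuclideanSpace ℝ (Fin d) → EuclideanSpace ℝ (Fin l) → Fin d → ℝ)
    (S : EuclideanSpace ℝ (Fin d) → EuclideanSpace ℝ (Fin l) → Matrix (Fin d) (Fin d) ℝ)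
    (v w : EuclideanSpace ℝ (Fin d) → ℝ) (x : EuclideanSpace ℝ (Fin d)) : ℝ :=
  ∫ u in U,
    (r x u + (∑ i, b x u i * pd1 d w x i) + (1/2) * (∑ i, ∑ j, S x u i j * pd2 d w x j i) -
      lam * Real.log (gibbsPolicy d l lam U r b S v x u)) * gibbsPolicy d l lam U r b S v x u

namespace AdmissibleCoefficients

variable {d l : ℕ} {lam C₀ : ℝ} {U : Set (EuclideanSpace ℝ (Fin l))}
  {r : EuclideanSpace ℝ (Fin d) → EuclideanSpace ℝ (Fin l) → ℝ}
  {b : EuclideanSpace ℝ (Fin d) → EuclideanSpace ℝ (Fin l) → Fin d → ℝ}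
  {S : EuclideanSpace ℝ (Fin d) → EuclideanSpace ℝ (Fin l) → Matrix (Fin d) (Fin d) ℝ}

theorem isProbabilityMeasure_restrict (h : AdmissibleCoefficients d l C₀ U r b S) :
    IsProbabilityMeasure (volume.restrict U) :=
  ⟨by rw [Measure.restrict_apply_univ, h.volume_eq_one]⟩

theorem measurable_gibbsExponent (h : AdmissibleCoefficients d l C₀ U r b S)
    (x : EuclideanSpace ℝ (Fin d)) (p : Fin d → ℝ) (X : Matrix (Fin d) (Fin d) ℝ) :
    Measurable (gibbsExponent d l lam r b S x p X) := by
  have h1 := h.measurable_r x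
  have h2 := h.measurable_b x
  have h3 := h.measurable_S x
  unfold gibbsExponent
  fun_prop

theorem exists_abs_gibbsExponent_le (h : AdmissibleCoefficients d l C₀ U r b S)
    (x : EuclideanSpace ℝ (Fin d)) (p : Fin d → ℝ) (X : Matrix (Fin d) (Fin d) ℝ) :
    ∃ M, ∀ u ∈ U, |gibbsExponent d l lam r b S x p X u| ≤ M := by
  refine ⟨|1 / lam| * (C₀ + ∑ i, C₀ * |p i| + |1 / 2| * ∑ i, ∑ j, C₀ * |X j i|),
    fun u hu => ?_⟩
  rw [gibbsExponent, abs_mul]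
  gcongr
  refine (abs_add_le _ _).trans (add_le_add ((abs_add_le _ _).trans (add_le_add
    (h.abs_r_le u hu x) ((Finset.abs_sum_le_sum_abs _ _).trans
      (Finset.sum_le_sum fun i _ => ?_)))) ?_)
  · rw [abs_mul]
    exact mul_le_mul_of_nonneg_right (h.abs_b_le u hu x i) (abs_nonneg _)
  · rw [abs_mul]
    gcongr
    refine (Finset.abs_sum_le_sum_abs _ _).trans (Finset.sum_le_sum fun i _ =>
      (Finset.abs_sum_le_sum_abs _ _).trans (Finset.sum_le_sum fun j _ => ?_))
    rw [abs_mul]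
    exact mul_le_mul_of_nonneg_right (h.abs_S_le u hu x i j) (abs_nonneg _)

theorem integrable_of_abs_le (h : AdmissibleCoefficients d l C₀ U r b S)
    {f : EuclideanSpace ℝ (Fin l) → ℝ} {M : ℝ} (hf : Measurable f) (hM : ∀ u ∈ U, |f u| ≤ M) :
    Integrable f (volume.restrict U) := by
  have := h.isProbabilityMeasure_restrict
  exact Integrable.of_bound hf.aestronglyMeasurable M
    ((ae_restrict_iff' h.measurableSet).2 (Filter.Eventually.of_forall hM))

theorem integrable_exp_gibbsExponent (h : AdmissibleCoefficients d l C₀ U r b S)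
    (x : EuclideanSpace ℝ (Fin d)) (p : Fin d → ℝ) (X : Matrix (Fin d) (Fin d) ℝ) :
    Integrable (fun u => exp (gibbsExponent d l lam r b S x p X u)) (volume.restrict U) := by
  obtain ⟨M, hM⟩ := h.exists_abs_gibbsExponent_le (lam := lam) x p X
  refine h.integrable_of_abs_le (M := exp M) (h.measurable_gibbsExponent x p X).exp fun u hu => ?_
  rw [abs_exp]
  exact exp_le_exp.2 (abs_le.1 (hM u hu)).2

theorem partition_pos (h : AdmissibleCoefficients d l C₀ U r b S)
    (x : EuclideanSpace ℝ (Fin d)) (p : Fin d → ℝ) (X : Matrix (Fin d) (Fin d) ℝ) :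
    0 < ∫ u in U, exp (gibbsExponent d l lam r b S x p X u) := by
  have := h.isProbabilityMeasure_restrict
  exact integral_exp_pos (h.integrable_exp_gibbsExponent x p X)

theorem gibbsPolicy_pos (h : AdmissibleCoefficients d l C₀ U r b S)
    (v : EuclideanSpace ℝ (Fin d) → ℝ) (x : EuclideanSpace ℝ (Fin d))
    (u : EuclideanSpace ℝ (Fin l)) : 0 < gibbsPolicy d l lam U r b S v x u :=
  div_pos (exp_pos _) (h.partition_pos x _ _)

theorem measurable_gibbsPolicy (h : AdmissibleCoefficients d l C₀ U r b S)
    (v : EuclideanSpace ℝ (Fin d) → ℝ) (x : EuclideanSpace ℝ (Fin d)) :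
    Measurable (gibbsPolicy d l lam U r b S v x) :=
  (h.measurable_gibbsExponent x _ _).exp.div_const _

theorem integrable_gibbsPolicy (h : AdmissibleCoefficients d l C₀ U r b S)
    (v : EuclideanSpace ℝ (Fin d) → ℝ) (x : EuclideanSpace ℝ (Fin d)) :
    Integrable (gibbsPolicy d l lam U r b S v x) (volume.restrict U) :=
  (h.integrable_exp_gibbsExponent x _ _).div_const _

theorem integral_gibbsPolicy (h : AdmissibleCoefficients d l C₀ U r b S)
    (v : EuclideanSpace ℝ (Fin d) → ℝ) (x : EuclideanSpace ℝ (Fin d)) :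
    ∫ u in U, gibbsPolicy d l lam U r b S v x u = 1 := by
  simp only [gibbsPolicy, gibbsDensity]
  rw [integral_div, div_self (h.partition_pos x _ _).ne']

theorem integrable_mul_gibbsPolicy (h : AdmissibleCoefficients d l C₀ U r b S)
    (v : EuclideanSpace ℝ (Fin d) → ℝ) (x : EuclideanSpace ℝ (Fin d))
    {f : EuclideanSpace ℝ (Fin l) → ℝ} {M : ℝ} (hf : Measurable f) (hM : ∀ u ∈ U, |f u| ≤ M) :
    Integrable (fun u => f u * gibbsPolicy d l lam U r b S v x u) (volume.restrict U) :=
  (h.integrable_gibbsPolicy v x).bdd_mul hf.aestronglyMeasurable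
    ((ae_restrict_iff' h.measurableSet).2 (Filter.Eventually.of_forall hM))

theorem abs_integral_mul_gibbsPolicy_le (h : AdmissibleCoefficients d l C₀ U r b S)
    (v : EuclideanSpace ℝ (Fin d) → ℝ) (x : EuclideanSpace ℝ (Fin d))
    {f : EuclideanSpace ℝ (Fin l) → ℝ} {M : ℝ} (hM : ∀ u ∈ U, |f u| ≤ M) :
    |∫ u in U, f u * gibbsPolicy d l lam U r b S v x u| ≤ M := by
  have h1 := norm_integral_le_of_norm_le (μ := volume.restrict U)
    (f := fun u => f u * gibbsPolicy d l lam U r b S v x u)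
    ((h.integrable_gibbsPolicy v x).const_mul M)
    ((ae_restrict_iff' h.measurableSet).2 (Filter.Eventually.of_forall fun u hu => by
      rw [norm_mul, Real.norm_eq_abs, Real.norm_eq_abs, abs_of_pos (h.gibbsPolicy_pos v x u)]
      exact mul_le_mul_of_nonneg_right (hM u hu) (h.gibbsPolicy_pos v x u).le))
  rwa [integral_const_mul, h.integral_gibbsPolicy, mul_one] at h1

theorem log_gibbsPolicy (h : AdmissibleCoefficients d l C₀ U r b S)
    (v : EuclideanSpace ℝ (Fin d) → ℝ) (x : EuclideanSpace ℝ (Fin d))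
    (u : EuclideanSpace ℝ (Fin l)) :
    log (gibbsPolicy d l lam U r b S v x u) =
      gibbsExponent d l lam r b S x (fun i => pd1 d v x i) (hessian d v x) u -
        log (∫ u' in U, exp
          (gibbsExponent d l lam r b S x (fun i => pd1 d v x i) (hessian d v x) u')) := by
  rw [gibbsPolicy, gibbsDensity, log_div (exp_pos _).ne' (h.partition_pos x _ _).ne', log_exp]

theorem exists_abs_log_gibbsPolicy_le (h : AdmissibleCoefficients d l C₀ U r b S)
    (v : EuclideanSpace ℝ (Fin d) → ℝ) (x : EuclideanSpace ℝ (Fin d)) :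
    ∃ M, ∀ u ∈ U, |log (gibbsPolicy d l lam U r b S v x u)| ≤ M := by
  obtain ⟨M, hM⟩ := h.exists_abs_gibbsExponent_le (lam := lam) x (fun i => pd1 d v x i)
    (hessian d v x)
  refine ⟨M + |log (∫ u' in U, exp
    (gibbsExponent d l lam r b S x (fun i => pd1 d v x i) (hessian d v x) u'))|, fun u hu => ?_⟩
  rw [h.log_gibbsPolicy]
  exact (abs_sub _ _).trans (add_le_add_left (hM u hu) _)

theorem policyHamiltonian_eq (hlam : lam ≠ 0) (v w : EuclideanSpace ℝ (Fin d) → ℝ)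
    (x : EuclideanSpace ℝ (Fin d)) :
    policyHamiltonian d l lam U r b S v w x = lam * ∫ u in U,
      (gibbsExponent d l lam r b S x (fun i => pd1 d w x i) (hessian d w x) u -
        log (gibbsPolicy d l lam U r b S v x u)) * gibbsPolicy d l lam U r b S v x u := by
  rw [policyHamiltonian, ← integral_const_mul]
  refine integral_congr_ae (Filter.Eventually.of_forall fun u => ?_)
  simp only [gibbsExponent, hessian, Matrix.of_apply]
  field_simp

theorem policyHamiltonian_self (h : AdmissibleCoefficients d l C₀ U r b S) (hlam : lam ≠ 0)
    (v : EuclideanSpace ℝ (Fin d) → ℝ) (x : EuclideanSpace ℝ (Fin d)) :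
    policyHamiltonian d l lam U r b S v v x =
      expF d l lam U r b S x (fun i => pd1 d v x i) (hessian d v x) := by
  rw [policyHamiltonian_eq hlam, expF]
  simp only [h.log_gibbsPolicy, sub_sub_cancel]
  rw [integral_const_mul, h.integral_gibbsPolicy, mul_one]

theorem policyHamiltonian_le (h : AdmissibleCoefficients d l C₀ U r b S) (hlam : 0 < lam)
    (v w : EuclideanSpace ℝ (Fin d) → ℝ) (x : EuclideanSpace ℝ (Fin d)) :
    policyHamiltonian d l lam U r b S v w x ≤
      expF d l lam U r b S x (fun i => pd1 d w x i) (hessian d w x) := by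
  have := h.isProbabilityMeasure_restrict
  rw [policyHamiltonian_eq hlam.ne', expF]
  refine mul_le_mul_of_nonneg_left ?_ hlam.le
  obtain ⟨M, hM⟩ := h.exists_abs_gibbsExponent_le (lam := lam) x (fun i => pd1 d w x i)
    (hessian d w x)
  obtain ⟨N, hN⟩ := h.exists_abs_log_gibbsPolicy_le (lam := lam) v x
  refine integral_sub_log_mul_le_log_integral_exp (h.integrable_exp_gibbsExponent x _ _)
    (h.integrable_gibbsPolicy v x) (h.gibbsPolicy_pos v x) (h.integral_gibbsPolicy v x)
    (h.integrable_mul_gibbsPolicy v x (M := M + N)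
      ((h.measurable_gibbsExponent x _ _).sub (h.measurable_gibbsPolicy v x).log)
      fun u hu => (abs_sub _ _).trans (add_le_add (hM u hu) (hN u hu)))

/-- The Hamiltonian of a fixed policy is affine in the first and second derivatives, with averaged
coefficients. -/
theorem policyHamiltonian_affine (h : AdmissibleCoefficients d l C₀ U r b S)
    (v w : EuclideanSpace ℝ (Fin d) → ℝ) (x : EuclideanSpace ℝ (Fin d)) :
    policyHamiltonian d l lam U r b S v w x =
      (∫ u in U, (r x u - lam * log (gibbsPolicy d l lam U r b S v x u)) *
          gibbsPolicy d l lam U r b S v x u) +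
        (∑ i, (∫ u in U, b x u i * gibbsPolicy d l lam U r b S v x u) * pd1 d w x i +
        (1 / 2) * ∑ i, ∑ j,
          (∫ u in U, S x u i j * gibbsPolicy d l lam U r b S v x u) * pd2 d w x j i) := by
  obtain ⟨N, hN⟩ := h.exists_abs_log_gibbsPolicy_le (lam := lam) v x
  have hr : Integrable (fun u => (r x u - lam * log (gibbsPolicy d l lam U r b S v x u)) *
      gibbsPolicy d l lam U r b S v x u) (volume.restrict U) :=
    h.integrable_mul_gibbsPolicy v x (M := C₀ + |lam| * N)
      ((h.measurable_r x).sub ((h.measurable_gibbsPolicy v x).log.const_mul lam)) fun u hu =>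
      (abs_sub _ _).trans (add_le_add (h.abs_r_le u hu x) (by
        rw [abs_mul]
        exact mul_le_mul_of_nonneg_left (hN u hu) (abs_nonneg _)))
  have hb : ∀ i, Integrable
      (fun u => b x u i * gibbsPolicy d l lam U r b S v x u * pd1 d w x i)
      (volume.restrict U) := fun i =>
    (h.integrable_mul_gibbsPolicy v x (h.measurable_b x i)
      fun u hu => h.abs_b_le u hu x i).mul_const _
  have hS : ∀ i j, Integrable
      (fun u => S x u i j * gibbsPolicy d l lam U r b S v x u * pd2 d w x j i)
      (volume.restrict U) := fun i j =>
    (h.integrable_mul_gibbsPolicy v x (h.measurable_S x i j)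
      fun u hu => h.abs_S_le u hu x i j).mul_const _
  have hb' := integrable_finsetSum Finset.univ fun i _ => hb i
  have hS' := fun i => integrable_finsetSum Finset.univ fun j _ => hS i j
  have hS'' := (integrable_finsetSum Finset.univ fun i _ => hS' i).const_mul (1 / 2)
  simp only [← integral_mul_const]
  simp only [← integral_finsetSum _ fun j _ => hS _ j]
  have hsum := integral_add hr (hb'.add hS'')
  simp only [Pi.add_apply] at hsum
  rw [← integral_finsetSum _ fun i _ => hb i, ← integral_finsetSum _ fun i _ => hS' i,
    ← integral_const_mul, ← integral_add hb' hS'', ← hsum, policyHamiltonian]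
  refine integral_congr_ae (Filter.Eventually.of_forall fun u => ?_)
  simp only [mul_right_comm _ (gibbsPolicy d l lam U r b S v x u) _, ← Finset.sum_mul]
  ring

theorem quadratic_integral_nonneg (h : AdmissibleCoefficients d l C₀ U r b S)
    (v : EuclideanSpace ℝ (Fin d) → ℝ) (x : EuclideanSpace ℝ (Fin d)) (ξ : Fin d → ℝ) :
    0 ≤ ∑ i, ∑ j,
      ξ i * (∫ u in U, S x u i j * gibbsPolicy d l lam U r b S v x u) * ξ j := by
  have hint : ∀ i j, Integrable
      (fun u => ξ i * (S x u i j * gibbsPolicy d l lam U r b S v x u) * ξ j)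
      (volume.restrict U) := fun i j =>
    ((h.integrable_mul_gibbsPolicy v x (h.measurable_S x i j)
      fun u hu => h.abs_S_le u hu x i j).const_mul _).mul_const _
  simp only [← integral_const_mul, ← integral_mul_const]
  simp only [← integral_finsetSum _ fun j _ => hint _ j]
  rw [← integral_finsetSum _ fun i _ => integrable_finsetSum _ fun j _ => hint i j]
  refine setIntegral_nonneg h.measurableSet fun u hu => ?_
  have := mul_nonneg (h.quadratic_nonneg u hu x ξ)
    (h.gibbsPolicy_pos (lam := lam) v x u).le
  refine this.trans_eq ?_
  simp only [Finset.sum_mul]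
  exact Finset.sum_congr rfl fun i _ => Finset.sum_congr rfl fun j _ => by ring

/-- Comparison principle for sub- and supersolutions of the linear equation of a fixed Gibbs
policy. -/
theorem le_of_policy_sub_super (h : AdmissibleCoefficients d l C₀ U r b S) {ρ : ℝ} (hρ : 0 < ρ)
    (v : EuclideanSpace ℝ (Fin d) → ℝ) {w₁ w₂ : EuclideanSpace ℝ (Fin d) → ℝ}
    (hw₁ : Differentiable ℝ w₁) (hw₁' : Differentiable ℝ (fderiv ℝ w₁))
    (hw₂ : Differentiable ℝ w₂) (hw₂' : Differentiable ℝ (fderiv ℝ w₂))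
    (hbdd₁ : ∃ M, ∀ x, |w₁ x| ≤ M) (hbdd₂ : ∃ M, ∀ x, |w₂ x| ≤ M)
    (hsub : ∀ x, ρ * w₁ x ≤ policyHamiltonian d l lam U r b S v w₁ x)
    (hsuper : ∀ x, policyHamiltonian d l lam U r b S v w₂ x ≤ ρ * w₂ x)
    (x : EuclideanSpace ℝ (Fin d)) : w₁ x ≤ w₂ x := by
  have hfd : fderiv ℝ (w₁ - w₂) = fderiv ℝ w₁ - fderiv ℝ w₂ :=
    funext fun y => fderiv_sub (hw₁ y) (hw₂ y)
  have hfd' : Differentiable ℝ (fderiv ℝ (w₁ - w₂)) := hfd ▸ hw₁'.sub hw₂'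
  have h1 : ∀ y i, pd1 d (w₁ - w₂) y i = pd1 d w₁ y i - pd1 d w₂ y i := fun y i => by
    simp [pd1, hfd]
  have h2 : ∀ y i j, pd2 d (w₁ - w₂) y i j = pd2 d w₁ y i j - pd2 d w₂ y i j := fun y i j => by
    rw [pd2_eq_fderiv_fderiv hfd', pd2_eq_fderiv_fderiv hw₁', pd2_eq_fderiv_fderiv hw₂', hfd,
      fderiv_sub (hw₁' y) (hw₂' y)]
    simp
  obtain ⟨M₁, hM₁⟩ := hbdd₁
  obtain ⟨M₂, hM₂⟩ := hbdd₂
  refine sub_nonpos.1 (nonpos_of_elliptic_subsolution (w := w₁ - w₂) (C := C₀) hρ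
    (B := fun y i => ∫ u in U, b y u i * gibbsPolicy d l lam U r b S v y u)
    (A := fun y => Matrix.of fun i j => ∫ u in U, S y u i j * gibbsPolicy d l lam U r b S v y u)
    (hw₁.sub hw₂) hfd' ⟨M₁ + M₂, fun y => ?_⟩
    (fun y i => h.abs_integral_mul_gibbsPolicy_le v y fun u hu => h.abs_b_le u hu y i)
    (fun y i j => h.abs_integral_mul_gibbsPolicy_le v y fun u hu => h.abs_S_le u hu y i j)
    (fun y ξ => h.quadratic_integral_nonneg v y ξ) (fun y => ?_) x)
  · have := (abs_le.1 (hM₁ y)).2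
    have := (abs_le.1 (hM₂ y)).1
    simp only [Pi.sub_apply]
    linarith
  · have e1 := hsub y
    have e2 := hsuper y
    rw [h.policyHamiltonian_affine] at e1 e2
    simp only [Pi.sub_apply, h1, h2, mul_sub, Finset.sum_sub_distrib, Matrix.of_apply]
    linarith

theorem tendsto_policyHamiltonian_sub (h : AdmissibleCoefficients d l C₀ U r b S)
    {v w₁ w₂ : ℕ → EuclideanSpace ℝ (Fin d) → ℝ} {x : EuclideanSpace ℝ (Fin d)}
    (h1 : ∀ i, Filter.Tendsto (fun n => pd1 d (w₁ n) x i - pd1 d (w₂ n) x i)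
      Filter.atTop (nhds 0))
    (h2 : ∀ i j, Filter.Tendsto (fun n => pd2 d (w₁ n) x i j - pd2 d (w₂ n) x i j)
      Filter.atTop (nhds 0)) :
    Filter.Tendsto (fun n => policyHamiltonian d l lam U r b S (v n) (w₁ n) x -
      policyHamiltonian d l lam U r b S (v n) (w₂ n) x) Filter.atTop (nhds 0) := by
  have hB : ∀ i, Filter.Tendsto (fun n => (∫ u in U, b x u i *
      gibbsPolicy d l lam U r b S (v n) x u) * (pd1 d (w₁ n) x i - pd1 d (w₂ n) x i))
      Filter.atTop (nhds 0) := fun i =>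
    bdd_le_mul_tendsto_zero'
      C₀ (Filter.Eventually.of_forall fun n =>
        h.abs_integral_mul_gibbsPolicy_le (v n) x fun u hu => h.abs_b_le u hu x i) (h1 i)
  have hA : ∀ i j, Filter.Tendsto (fun n => (∫ u in U, S x u i j *
      gibbsPolicy d l lam U r b S (v n) x u) * (pd2 d (w₁ n) x j i - pd2 d (w₂ n) x j i))
      Filter.atTop (nhds 0) := fun i j =>
    bdd_le_mul_tendsto_zero'
      C₀ (Filter.Eventually.of_forall fun n =>
        h.abs_integral_mul_gibbsPolicy_le (v n) x fun u hu => h.abs_S_le u hu x i j) (h2 j i)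
  have := (tendsto_finsetSum Finset.univ fun i _ => hB i).add
    ((tendsto_finsetSum Finset.univ fun i _ =>
      tendsto_finsetSum Finset.univ fun j _ => hA i j).const_mul (1 / 2))
  simp only [Finset.sum_const_zero, mul_zero, add_zero] at this
  refine this.congr fun n => ?_
  rw [h.policyHamiltonian_affine, h.policyHamiltonian_affine]
  simp only [mul_sub, Finset.sum_sub_distrib]
  ring

end AdmissibleCoefficients

theorem tendsto_pd1 {d : ℕ} {f : ℕ → EuclideanSpace ℝ (Fin d) → ℝ}
    {g : EuclideanSpace ℝ (Fin d) → ℝ} {x : EuclideanSpace ℝ (Fin d)}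
    (h : Filter.Tendsto (fun n => fderiv ℝ (f n) x) Filter.atTop (nhds (fderiv ℝ g x)))
    (i : Fin d) :
    Filter.Tendsto (fun n => pd1 d (f n) x i) Filter.atTop (nhds (pd1 d g x i)) :=
  ((ContinuousLinearMap.apply ℝ ℝ (EuclideanSpace.single i (1 : ℝ))).continuous.tendsto _).comp h

theorem tendsto_pd2 {d : ℕ} {f : ℕ → EuclideanSpace ℝ (Fin d) → ℝ}
    {g : EuclideanSpace ℝ (Fin d) → ℝ} {x : EuclideanSpace ℝ (Fin d)}
    (hf : ∀ n, Differentiable ℝ (fderiv ℝ (f n))) (hg : Differentiable ℝ (fderiv ℝ g))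
    (h : Filter.Tendsto (fun n => fderiv ℝ (fderiv ℝ (f n)) x) Filter.atTop
      (nhds (fderiv ℝ (fderiv ℝ g) x)))
    (i j : Fin d) :
    Filter.Tendsto (fun n => pd2 d (f n) x i j) Filter.atTop (nhds (pd2 d g x i j)) := by
  simp only [pd2_eq_fderiv_fderiv hg, fun n => pd2_eq_fderiv_fderiv (hf n)]
  have hi := ((ContinuousLinearMap.apply ℝ (EuclideanSpace ℝ (Fin d) →L[ℝ] ℝ)
    (EuclideanSpace.single i (1 : ℝ))).continuous.tendsto _).comp h
  exact ((ContinuousLinearMap.apply ℝ ℝ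
    (EuclideanSpace.single j (1 : ℝ))).continuous.tendsto _).comp hi

/-- Theorem 3.1: if the policy iteration sequence is uniformly bounded in `C^{2,α}(ℝ^d)`,
then it converges to the solution `v*` of the exploratory HJB equation in `C²` locally
uniformly: `v^n → v*`, `Dv^n → Dv*`, `D²v^n → D²v*` uniformly on compact sets. -/
theorem stmt6 (d l : ℕ) (α lam C₀ ρ : ℝ)
    (hα0 : 0 < α) (hα1 : α < 1) (hlam : 0 < lam) (hC₀ : 1 ≤ C₀) (hρ : 0 < ρ)
    (U : Set (EuclideanSpace ℝ (Fin l)))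
    (r : EuclideanSpace ℝ (Fin d) → EuclideanSpace ℝ (Fin l) → ℝ)
    (b : EuclideanSpace ℝ (Fin d) → EuclideanSpace ℝ (Fin l) → Fin d → ℝ)
    (S : EuclideanSpace ℝ (Fin d) → EuclideanSpace ℝ (Fin l) → Matrix (Fin d) (Fin d) ℝ)
    (vstar : EuclideanSpace ℝ (Fin d) → ℝ)
    (v : ℕ → EuclideanSpace ℝ (Fin d) → ℝ)
    (hUmeas : MeasurableSet U) (hUbdd : Bornology.IsBounded U) (hUvol : volume U = 1)
    -- measurability in the control variable
    (hrmeas : ∀ x, Measurable fun u => r x u)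
    (hbmeas : ∀ x i, Measurable fun u => b x u i)
    (hSmeas : ∀ x i j, Measurable fun u => S x u i j)
    -- (cond1)
    (hell : ∀ u ∈ U, ∀ x (ξ : Fin d → ℝ),
      (1 / C₀) * ∑ i, ξ i ^ 2 ≤ ∑ i, ∑ j, ξ i * S x u i j * ξ j)
    (hr1 : ∀ u ∈ U, ∀ x, |r x u| ≤ C₀)
    (hr2 : ∀ u ∈ U, ∀ x y, dist x y ≤ 1 → |r x u - r y u| ≤ C₀ * dist x y ^ α)
    (hb1 : ∀ u ∈ U, ∀ x i, |b x u i| ≤ C₀)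
    (hb2 : ∀ u ∈ U, ∀ x y, dist x y ≤ 1 → ∀ i, |b x u i - b y u i| ≤ C₀ * dist x y ^ α)
    (hS1 : ∀ u ∈ U, ∀ x i j, |S x u i j| ≤ C₀)
    (hS2 : ∀ u ∈ U, ∀ x y, dist x y ≤ 1 → ∀ i j, |S x u i j - S y u i j| ≤ C₀ * dist x y ^ α)
    -- v* is a bounded classical solution of the exploratory HJB equation
    (hvstar : ContDiff ℝ 2 vstar) (hvstarbdd : ∃ M, ∀ x, |vstar x| ≤ M)
    (hHJB : ∀ x, ρ * vstar x =
      expF d l lam U r b S x (fun i => pd1 d vstar x i) (hessian d vstar x))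
    -- v⁰ ∈ C^{2,α}(ℝ^d) is bounded
    (hv0 : ContDiff ℝ 2 (v 0)) (hv0bdd : ∃ M, ∀ x, |v 0 x| ≤ M)
    (hv0hold : ∃ K, ∀ x y, dist x y ≤ 1 →
      ‖iteratedFDeriv ℝ 2 (v 0) x - iteratedFDeriv ℝ 2 (v 0) y‖ ≤ K * dist x y ^ α)
    -- iterates: v^{n+1} is a bounded C² classical solution of
    -- ρ v^{n+1} = F_{π^{n+1}}(x, Dv^{n+1}, D²v^{n+1}) with π^{n+1} = Γ(·, Dv^n, D²v^n)
    (hvreg : ∀ n : ℕ, ContDiff ℝ 2 (v (n + 1)) ∧ ∃ M, ∀ x, |v (n + 1) x| ≤ M)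
    (hiter : ∀ (n : ℕ) (x : EuclideanSpace ℝ (Fin d)),
      ρ * v (n + 1) x =
        ∫ u in U,
          (r x u + (∑ i, b x u i * pd1 d (v (n + 1)) x i) +
            (1/2) * (∑ i, ∑ j, S x u i j * pd2 d (v (n + 1)) x j i) -
            lam * Real.log (gibbsPolicy d l lam U r b S (v n) x u)) *
          gibbsPolicy d l lam U r b S (v n) x u)
    -- uniform C^{2,α} bound: sup_n ‖v^n‖_{2,α} < ∞
    (hunif : ∃ K : ℝ, (∀ (n : ℕ) (x : EuclideanSpace ℝ (Fin d)),
        |v n x| + ‖fderiv ℝ (v n) x‖ + ‖iteratedFDeriv ℝ 2 (v n) x‖ ≤ K) ∧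
      (∀ (n : ℕ) (x y : EuclideanSpace ℝ (Fin d)), dist x y ≤ 1 →
        |v n x - v n y| + ‖fderiv ℝ (v n) x - fderiv ℝ (v n) y‖ +
          ‖iteratedFDeriv ℝ 2 (v n) x - iteratedFDeriv ℝ 2 (v n) y‖ ≤ K * dist x y ^ α)) :
    ∀ s : Set (EuclideanSpace ℝ (Fin d)), IsCompact s →
      TendstoUniformlyOn (fun n x => v n x) vstar Filter.atTop s ∧
      TendstoUniformlyOn (fun n x => fderiv ℝ (v n) x) (fun x => fderiv ℝ vstar x)
        Filter.atTop s ∧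
      TendstoUniformlyOn (fun n x => iteratedFDeriv ℝ 2 (v n) x)
        (fun x => iteratedFDeriv ℝ 2 vstar x) Filter.atTop s := by
  obtain ⟨K, hKb, hKh⟩ := hunif
  have H : AdmissibleCoefficients d l C₀ U r b S :=
    ⟨hUmeas, hUvol, hrmeas, hbmeas, hSmeas, fun u hu x ξ => le_trans (by positivity)
      (hell u hu x ξ), hr1, hb1, hS1⟩
  have hC2 : ∀ n, ContDiff ℝ 2 (v n) := fun n => by
    cases n with
    | zero => exact hv0
    | succ n => exact (hvreg n).1
  have hdiff : ∀ f : EuclideanSpace ℝ (Fin d) → ℝ, ContDiff ℝ 2 f →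
      Differentiable ℝ f ∧ Differentiable ℝ (fderiv ℝ f) := fun f hf =>
    ⟨hf.differentiable (by norm_num),
      (hf.fderiv_right (m := 1) (by norm_num)).differentiable (by norm_num)⟩
  have hd1 := fun n => (hdiff _ (hC2 n)).1
  have hd2 := fun n => (hdiff _ (hC2 n)).2
  have hb0 : ∀ n x, |v n x| ≤ K := fun n x => by
    have := hKb n x
    have := norm_nonneg (fderiv ℝ (v n) x)
    have := norm_nonneg (iteratedFDeriv ℝ 2 (v n) x)
    linarith
  have hb1' : ∀ n x, ‖fderiv ℝ (v n) x‖ ≤ K := fun n x => by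
    have := hKb n x
    have := abs_nonneg (v n x)
    have := norm_nonneg (iteratedFDeriv ℝ 2 (v n) x)
    linarith
  have hb2' : ∀ n x, ‖fderiv ℝ (fderiv ℝ (v n)) x‖ ≤ K := fun n x => by
    rw [norm_fderiv_fderiv_eq]
    have := hKb n x
    have := abs_nonneg (v n x)
    have := norm_nonneg (fderiv ℝ (v n) x)
    linarith
  have hh0 : ∀ n x y, dist x y ≤ 1 → ‖v n x - v n y‖ ≤ K * dist x y ^ α := fun n x y hxy => by
    rw [Real.norm_eq_abs]
    have := hKh n x y hxy
    have := norm_nonneg (fderiv ℝ (v n) x - fderiv ℝ (v n) y)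
    have := norm_nonneg (iteratedFDeriv ℝ 2 (v n) x - iteratedFDeriv ℝ 2 (v n) y)
    linarith
  have hh1 : ∀ n x y, dist x y ≤ 1 →
      ‖fderiv ℝ (v n) x - fderiv ℝ (v n) y‖ ≤ K * dist x y ^ α := fun n x y hxy => by
    have := hKh n x y hxy
    have := abs_nonneg (v n x - v n y)
    have := norm_nonneg (iteratedFDeriv ℝ 2 (v n) x - iteratedFDeriv ℝ 2 (v n) y)
    linarith
  have hh2 : ∀ n x y, dist x y ≤ 1 →
      ‖fderiv ℝ (fderiv ℝ (v n)) x - fderiv ℝ (fderiv ℝ (v n)) y‖ ≤ K * dist x y ^ α :=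
    fun n x y hxy => by
      rw [norm_fderiv_fderiv_sub_eq]
      have := hKh n x y hxy
      have := abs_nonneg (v n x - v n y)
      have := norm_nonneg (fderiv ℝ (v n) x - fderiv ℝ (v n) y)
      linarith
  have heq : ∀ n x, ρ * v (n + 1) x = policyHamiltonian d l lam U r b S (v n) (v (n + 1)) x :=
    hiter
  have hsub : ∀ n x, ρ * v (n + 1) x ≤
      policyHamiltonian d l lam U r b S (v (n + 1)) (v (n + 1)) x := fun n x => by
    rw [heq, H.policyHamiltonian_self hlam.ne']
    exact H.policyHamiltonian_le hlam _ _ _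
  have hmono : ∀ x, Monotone fun n => v (n + 1) x := fun x =>
    monotone_nat_of_le_succ fun n => H.le_of_policy_sub_super hρ (v (n + 1)) (hd1 _) (hd2 _)
      (hd1 _) (hd2 _) ⟨K, hb0 _⟩ ⟨K, hb0 _⟩ (hsub n) (fun y => (heq (n + 1) y).ge) x
  obtain ⟨g, hg⟩ : ∃ g : EuclideanSpace ℝ (Fin d) → ℝ,
      ∀ x, Filter.Tendsto (fun n => v n x) Filter.atTop (nhds (g x)) :=
    ⟨fun x => ⨆ n, v (n + 1) x, fun x => (Filter.tendsto_add_atTop_iff_nat 1).1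
      (tendsto_atTop_ciSup (hmono x) ⟨K, by
        rintro _ ⟨n, rfl⟩
        exact (abs_le.1 (hb0 _ x)).2⟩)⟩
  obtain ⟨hg1, hlim1⟩ := tendsto_fderiv_of_holder hα0 hd1 hb1' hh1 hg
  obtain ⟨hg2, hlim2⟩ := tendsto_fderiv_of_holder hα0 hd2 hb2' hh2 hlim1
  have hgb : ∃ M, ∀ x, |g x| ≤ M :=
    ⟨K, fun x => le_of_tendsto (hg x).abs (Filter.Eventually.of_forall fun n => hb0 n x)⟩
  obtain ⟨hs1, hs2⟩ := hdiff _ hvstar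
  have hstar : ∀ x, ρ * vstar x = policyHamiltonian d l lam U r b S vstar vstar x := fun x => by
    rw [hHJB, H.policyHamiltonian_self hlam.ne']
  have hle : ∀ x, g x ≤ vstar x := fun x =>
    le_of_tendsto ((Filter.tendsto_add_atTop_iff_nat 1).2 (hg x))
      (Filter.Eventually.of_forall fun n => H.le_of_policy_sub_super hρ (v n) (hd1 _) (hd2 _)
        hs1 hs2 ⟨K, hb0 _⟩ hvstarbdd (fun y => (heq n y).le) (fun y => by
          rw [hHJB]
          exact H.policyHamiltonian_le hlam _ _ _) x)
  have hsuper : ∀ x, policyHamiltonian d l lam U r b S vstar g x ≤ ρ * g x := fun x => by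
    have hp1 := tendsto_pd1 (hlim1 x)
    have hp2 := tendsto_pd2 hd2 hg2 (hlim2 x)
    have e1 := H.tendsto_policyHamiltonian_sub (lam := lam) (v := fun _ => vstar)
      (w₁ := fun n => v (n + 1)) (w₂ := fun _ => g) (x := x)
      (fun i => by
        simpa using ((Filter.tendsto_add_atTop_iff_nat 1).2 (hp1 i)).sub_const (pd1 d g x i))
      (fun i j => by
        simpa using
          ((Filter.tendsto_add_atTop_iff_nat 1).2 (hp2 i j)).sub_const (pd2 d g x i j))
    have e2 := H.tendsto_policyHamiltonian_sub (lam := lam) (v := fun n => v (n + 1))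
      (w₁ := fun n => v (n + 1)) (w₂ := fun n => v (n + 2)) (x := x)
      (fun i => by
        simpa using ((Filter.tendsto_add_atTop_iff_nat 1).2 (hp1 i)).sub
          ((Filter.tendsto_add_atTop_iff_nat 2).2 (hp1 i)))
      (fun i j => by
        simpa using ((Filter.tendsto_add_atTop_iff_nat 1).2 (hp2 i j)).sub
          ((Filter.tendsto_add_atTop_iff_nat 2).2 (hp2 i j)))
    have e3 := e2.add (((Filter.tendsto_add_atTop_iff_nat 2).2 (hg x)).const_mul ρ)
    have e4 := e1.add_const (policyHamiltonian d l lam U r b S vstar g x)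
    rw [zero_add] at e3 e4
    refine le_of_tendsto_of_tendsto' e4 e3 fun n => ?_
    rw [heq (n + 1), sub_add_cancel, sub_add_cancel, H.policyHamiltonian_self hlam.ne' (v (n + 1))]
    exact H.policyHamiltonian_le hlam _ _ _
  have hge : ∀ x, vstar x ≤ g x := H.le_of_policy_sub_super hρ vstar hs1 hs2 hg1 hg2 hvstarbdd
    hgb (fun x => (hstar x).le) hsuper
  obtain rfl : g = vstar := funext fun x => le_antisymm (hle x) (hge x)
  intro s hs
  refine ⟨tendstoUniformlyOn_of_holder hα0 hh0 hg hs,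
    tendstoUniformlyOn_of_holder hα0 hh1 hlim1 hs, ?_⟩
  have hunif2 := tendstoUniformlyOn_of_holder hα0 hh2 hlim2 hs
  rw [Metric.tendstoUniformlyOn_iff] at hunif2 ⊢
  simpa only [dist_eq_norm, norm_fderiv_fderiv_sub_eq] using hunif2
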